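/- Let n ≥ 4 be even and let w > 1. Then (w−1)²(w+1)/(w(wⁿ − 1)) ≤ λ₁(w) − λ₂(w) ≤ 2(w−1)(w+1)³/(w²(wⁿ − 1)). -/

import Mathlib

open Polynomial Real Filter

noncomputable def pathA (n : ℕ) (w : ℝ) : Matrix (Fin n) (Fin n) ℝ :=
  Matrix.of fun i j =>
    if i = j ∧ (i.val = 0 ∨ i.val = n - 1) then w
    else if i.val + 1 = j.val ∨ j.val + 1 = i.val then 1
    else 0

/-- `μ` lists the eigenvalues of `pathA n w` with multiplicity, in decreasing order. -/
def IsEigList (n : ℕ) (w : ℝ) (μ : Fin n → ℝ) : Prop :=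
  Antitone μ ∧ (pathA n w).charpoly = ∏ i, (Polynomial.X - Polynomial.C (μ i))

open Matrix Finset

/-- Two families with the same multiset of values differ by a permutation of the indices. -/
lemma exists_equiv_comp_eq {ι α : Type*} [Fintype ι] [DecidableEq α] (f g : ι → α)
    (h : univ.val.map f = univ.val.map g) : ∃ σ : ι ≃ ι, ∀ i, g (σ i) = f i := by
  have key : ∀ c, Nonempty ({a // f a = c} ≃ {b // g b = c}) := fun c => by
    refine ⟨Fintype.equivOfCardEq ?_⟩
    have h' := congrArg (Multiset.count c) h
    rw [Multiset.count_map, Multiset.count_map] at h'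
    rw [Fintype.card_subtype, Fintype.card_subtype]
    simpa [Finset.card_def, eq_comm] using h'
  refine ⟨Equiv.ofFiberEquiv fun c => (key c).some, fun i => ?_⟩
  exact Equiv.ofFiberEquiv_map _ i

/-- A Hermitian real matrix has an orthonormal eigenbasis indexed compatibly with any prescribed
enumeration of the roots of its characteristic polynomial. -/
lemma Matrix.IsHermitian.exists_eigenbasis_of_charpoly_eq {ι : Type*} [Fintype ι] [DecidableEq ι]
    {A : Matrix ι ι ℝ} (hA : A.IsHermitian) {μ : ι → ℝ}
    (hμ : A.charpoly = ∏ i, (X - C (μ i))) :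
    ∃ u : ι → ι → ℝ, (∀ i, A *ᵥ u i = μ i • u i) ∧
      (∀ i j, u i ⬝ᵥ u j = if i = j then 1 else 0) ∧
      ∀ x y, x ⬝ᵥ y = ∑ i, (u i ⬝ᵥ x) * (u i ⬝ᵥ y) := by
  have hroots : univ.val.map μ = univ.val.map hA.eigenvalues := by
    have h := congrArg Polynomial.roots (hμ.symm.trans hA.charpoly_eq)
    have hp : ∀ f : ι → ℝ, (∏ i, (X - C (f i))).roots = univ.val.map f := fun f => by
      rw [← Polynomial.roots_multiset_prod_X_sub_C (univ.val.map f), Multiset.map_map]; rfl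
    simpa [hp] using h
  obtain ⟨σ, hσ⟩ := exists_equiv_comp_eq _ _ hroots
  let b := hA.eigenvectorBasis.reindex σ.symm
  have hb : ∀ i, b i = hA.eigenvectorBasis (σ i) := fun i => by simp [b]
  refine ⟨fun i => b i, fun i => ?_, fun i j => ?_, fun x y => ?_⟩
  · beta_reduce
    rw [hb, hA.mulVec_eigenvectorBasis, hσ]
  · have := orthonormal_iff_ite.1 b.orthonormal i j
    rw [← this, EuclideanSpace.inner_eq_star_dotProduct, dotProduct_comm]
    simp
  · have := b.sum_inner_mul_inner (WithLp.toLp 2 x) (WithLp.toLp 2 y)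
    simp only [EuclideanSpace.inner_eq_star_dotProduct, star_trivial] at this
    rw [dotProduct_comm, ← this]
    refine Finset.sum_congr rfl fun i _ => ?_
    rw [dotProduct_comm y]

section QuadraticForm

variable {ι : Type*} [Fintype ι] {A : Matrix ι ι ℝ} {μ : ι → ℝ} {u : ι → ι → ℝ}

lemma dotProduct_mulVec_eq_sum_eigenvalues (hA : A.IsHermitian)
    (hu : ∀ i, A *ᵥ u i = μ i • u i)
    (hsum : ∀ x y, x ⬝ᵥ y = ∑ i, (u i ⬝ᵥ x) * (u i ⬝ᵥ y)) (x : ι → ℝ) :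
    x ⬝ᵥ A *ᵥ x = ∑ i, μ i * (u i ⬝ᵥ x) ^ 2 := by
  rw [hsum]
  refine Finset.sum_congr rfl fun i _ => ?_
  have hAt : Aᵀ = A := by simpa [IsHermitian, conjTranspose_eq_transpose_of_trivial] using hA
  rw [dotProduct_mulVec (u i), ← mulVec_transpose, hAt, hu, smul_dotProduct, smul_eq_mul]
  ring

lemma dotProduct_mulVec_le (hA : A.IsHermitian) (hu : ∀ i, A *ᵥ u i = μ i • u i)
    (hsum : ∀ x y, x ⬝ᵥ y = ∑ i, (u i ⬝ᵥ x) * (u i ⬝ᵥ y)) {c : ℝ} {x : ι → ℝ}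
    (hx : ∀ i, c < μ i → u i ⬝ᵥ x = 0) : x ⬝ᵥ A *ᵥ x ≤ c * (x ⬝ᵥ x) := by
  rw [dotProduct_mulVec_eq_sum_eigenvalues hA hu hsum, hsum, Finset.mul_sum]
  refine Finset.sum_le_sum fun i _ => ?_
  rcases lt_or_ge c (μ i) with h | h
  · simp [hx i h]
  · nlinarith [mul_le_mul_of_nonneg_right h (sq_nonneg (u i ⬝ᵥ x))]

/-- A case of the Courant–Fischer principle: if the quadratic form is at most `c` on a coordinate
hyperplane, then no two eigenvalues exceed `c`. -/
lemma eigenvalue_le_of_hyperplane [DecidableEq ι] (hu : ∀ i, A *ᵥ u i = μ i • u i)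
    (horth : ∀ i j, u i ⬝ᵥ u j = if i = j then 1 else 0)
    {c : ℝ} (k : ι) (hc : ∀ x : ι → ℝ, x k = 0 → x ⬝ᵥ A *ᵥ x ≤ c * (x ⬝ᵥ x))
    {i j : ι} (hij : i ≠ j) (hμ : μ j ≤ μ i) : μ j ≤ c := by
  have form : ∀ a b : ℝ, a * u i k + b * u j k = 0 →
      a ^ 2 * μ i + b ^ 2 * μ j ≤ c * (a ^ 2 + b ^ 2) := fun a b hab => by
    have h := hc (a • u i + b • u j) (by simpa using hab)
    simp only [mulVec_add, mulVec_smul, hu, dotProduct_add, add_dotProduct, smul_dotProduct,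
      dotProduct_smul, horth, hij, hij.symm, smul_eq_mul, if_true, if_false] at h
    linarith
  by_cases hj : u j k = 0
  · simpa using form 0 1 (by simp [hj])
  · have h := form (u j k) (-u i k) (by ring)
    have : 0 < u j k ^ 2 + (-u i k) ^ 2 := by positivity
    nlinarith [mul_le_mul_of_nonneg_left hμ (sq_nonneg (u j k))]

/-- An eigenvalue larger than all `μ i` with `i ≠ k` must be `μ k`, and it is then simple. -/
lemma eigenvalue_eq_of_forall_lt (hA : A.IsHermitian) (hu : ∀ i, A *ᵥ u i = μ i • u i)
    (hsum : ∀ x y, x ⬝ᵥ y = ∑ i, (u i ⬝ᵥ x) * (u i ⬝ᵥ y)) {k : ι} {ρ : ℝ}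
    (hρ : ∀ i, i ≠ k → μ i < ρ) {y : ι → ℝ} (hy : A *ᵥ y = ρ • y) (hy0 : 0 < y ⬝ᵥ y) :
    μ k = ρ ∧ ∀ z, y ⬝ᵥ z = 0 → u k ⬝ᵥ z = 0 := by
  have hAt : Aᵀ = A := by simpa [IsHermitian, conjTranspose_eq_transpose_of_trivial] using hA
  have hmul : ∀ i, μ i * (u i ⬝ᵥ y) = ρ * (u i ⬝ᵥ y) := fun i => by
    have h : u i ⬝ᵥ A *ᵥ y = (A *ᵥ u i) ⬝ᵥ y := by
      rw [dotProduct_mulVec, ← mulVec_transpose, hAt]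
    simpa [hy, hu] using h.symm
  have hzero : ∀ i, i ≠ k → u i ⬝ᵥ y = 0 := fun i hi => by
    by_contra h
    exact (hρ i hi).ne (mul_right_cancel₀ h (hmul i))
  have hk : ∀ z, y ⬝ᵥ z = (u k ⬝ᵥ y) * (u k ⬝ᵥ z) := fun z => by
    rw [hsum, Finset.sum_eq_single k (fun i _ hi => by simp [hzero i hi]) (by simp)]
  have hne : u k ⬝ᵥ y ≠ 0 := fun h => by simp [hk, h] at hy0
  exact ⟨mul_right_cancel₀ hne (hmul k), fun z hz =>
    (mul_eq_zero.1 ((hk z).symm.trans hz)).resolve_left hne⟩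

end QuadraticForm

section Path

lemma pathA_isHermitian (n : ℕ) (w : ℝ) : (pathA n w).IsHermitian := by
  ext i j
  simp only [pathA, conjTranspose_apply, of_apply, star_trivial]
  by_cases h : i = j
  · subst h; rfl
  · simp [h, Ne.symm h, or_comm]

lemma sum_fin_mul_eq (n : ℕ) (f g : ℕ → ℝ) :
    ((fun i : Fin n => f i) ⬝ᵥ fun i : Fin n => g i) = ∑ i ∈ range n, f i * g i :=
  (Finset.sum_range fun i => f i * g i).symm

lemma pathA_mulVec (k : ℕ) (w : ℝ) (f : ℕ → ℝ) (i : Fin (k + 1)) :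
    (pathA (k + 1) w *ᵥ fun j => f j) i =
      (if i.val = 0 ∨ i.val = k then w * f i else 0) +
        (if i.val < k then f (i + 1) else 0) + if 0 < i.val then f (i - 1) else 0 := by
  obtain ⟨i, hi⟩ := i
  have hsplit : ∀ j : Fin (k + 1), pathA (k + 1) w ⟨i, hi⟩ j * f j =
      (if i = j then (if i = 0 ∨ i = k then w * f i else 0) else 0) +
        (if i + 1 = j then f (i + 1) else 0) +
        if i - 1 = j then (if 0 < i then f (i - 1) else 0) else 0 := fun j => by
    obtain ⟨j, hj⟩ := j
    simp only [pathA, of_apply, Fin.mk.injEq, add_tsub_cancel_right]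
    grind
  simp only [mulVec, dotProduct, hsplit]
  rw [← Finset.sum_range fun j => (if i = j then (if i = 0 ∨ i = k then w * f i else 0) else 0) +
        (if i + 1 = j then f (i + 1) else 0) +
        if i - 1 = j then (if 0 < i then f (i - 1) else 0) else 0]
  simp only [Finset.sum_add_distrib, Finset.sum_ite_eq, Finset.mem_range]
  grind

lemma pathA_quadraticForm {k : ℕ} (hk : 0 < k) (w : ℝ) (f : ℕ → ℝ) :
    ((fun i : Fin (k + 1) => f i) ⬝ᵥ pathA (k + 1) w *ᵥ fun i => f i) =
      w * f 0 ^ 2 + w * f k ^ 2 + 2 * ∑ i ∈ range k, f i * f (i + 1) := by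
  simp only [dotProduct, pathA_mulVec]
  rw [← Finset.sum_range fun i => f i * ((if i = 0 ∨ i = k then w * f i else 0) +
        (if i < k then f (i + 1) else 0) + if 0 < i then f (i - 1) else 0)]
  simp only [mul_add, Finset.sum_add_distrib]
  have h1 : ∑ i ∈ range (k + 1), f i * (if i = 0 ∨ i = k then w * f i else 0) =
      w * f 0 ^ 2 + w * f k ^ 2 := by
    obtain ⟨m, rfl⟩ := Nat.exists_eq_succ_of_ne_zero hk.ne'
    rw [Finset.sum_range_succ, Finset.sum_range_succ', Finset.sum_eq_zero]
    · simp only [true_or, or_true, if_true, Nat.succ_eq_add_one]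
      ring
    · intro i hi
      have := Finset.mem_range.1 hi
      simp [this.ne]
  have h2 : ∑ i ∈ range (k + 1), f i * (if i < k then f (i + 1) else 0) =
      ∑ i ∈ range k, f i * f (i + 1) := by
    rw [Finset.sum_range_succ]
    simp only [lt_irrefl, if_false, mul_zero, add_zero]
    exact Finset.sum_congr rfl fun i hi => by simp [Finset.mem_range.1 hi]
  have h3 : ∑ i ∈ range (k + 1), f i * (if 0 < i then f (i - 1) else 0) =
      ∑ i ∈ range k, f i * f (i + 1) := by
    rw [Finset.sum_range_succ']
    simp [mul_comm]
  rw [h1, h2, h3]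
  ring

lemma pathA_quadraticForm_eq_sub_sum_sq (k : ℕ) {w : ℝ} (hw : 0 < w) (f : ℕ → ℝ) :
    w * f 0 ^ 2 + w * f k ^ 2 + 2 * ∑ i ∈ range k, f i * f (i + 1) =
      (w + w⁻¹) * ∑ i ∈ range (k + 1), f i ^ 2 + (w - w⁻¹) * f 0 ^ 2 -
        w⁻¹ * ∑ i ∈ range k, (w * f i - f (i + 1)) ^ 2 := by
  induction k with
  | zero => simp; ring
  | succ k ih =>
    rw [Finset.sum_range_succ, Finset.sum_range_succ _ (k + 1),
      Finset.sum_range_succ (fun i => (w * f i - f (i + 1)) ^ 2)]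
    have : w⁻¹ * (w * f k - f (k + 1)) ^ 2 =
        w * f k ^ 2 - 2 * (f k * f (k + 1)) + w⁻¹ * f (k + 1) ^ 2 := by
      field_simp
      ring
    linear_combination ih + this

lemma pathA_quadraticForm_le {k : ℕ} (hk : 0 < k) {w : ℝ} (hw : 0 < w) (x : Fin (k + 1) → ℝ)
    (hx : x 0 = 0) : x ⬝ᵥ pathA (k + 1) w *ᵥ x ≤ (w + w⁻¹) * (x ⬝ᵥ x) := by
  obtain ⟨f, rfl⟩ : ∃ f : ℕ → ℝ, x = fun i : Fin (k + 1) => f i :=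
    ⟨fun i => if h : i < k + 1 then x ⟨i, h⟩ else 0, by ext i; simp only [i.isLt, dif_pos]⟩
  have hf : f 0 = 0 := by simpa using hx
  rw [pathA_quadraticForm hk, pathA_quadraticForm_eq_sub_sum_sq k hw, sum_fin_mul_eq, hf]
  have : 0 ≤ w⁻¹ * ∑ i ∈ range k, (w * f i - f (i + 1)) ^ 2 := by positivity
  simp only [← sq]
  linarith

/-- The reflection-symmetric solution `t ^ i + t ^ (k - i)` of the eigenvalue recurrence on the
path with vertices `0, …, k`. -/
def symVec (k : ℕ) (t : ℝ) (i : ℕ) : ℝ := t ^ i + t ^ (k - i)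

lemma symVec_reflect {k i : ℕ} (t : ℝ) (hi : i ≤ k) : symVec k t (k - i) = symVec k t i := by
  rw [symVec, symVec, Nat.sub_sub_self hi, add_comm]

lemma sum_symVec_sq (k : ℕ) (t : ℝ) :
    ∑ i ∈ range (k + 1), symVec k t i ^ 2 =
      2 * (∑ i ∈ range (k + 1), (t ^ 2) ^ i + (k + 1) * t ^ k) := by
  have h1 : ∑ i ∈ range (k + 1), (t ^ 2) ^ (k - i) = ∑ i ∈ range (k + 1), (t ^ 2) ^ i := by
    simpa using Finset.sum_range_reflect (fun i => (t ^ 2) ^ i) (k + 1)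
  have h2 : ∀ i ∈ range (k + 1), symVec k t i ^ 2 =
      (t ^ 2) ^ i + (t ^ 2) ^ (k - i) + 2 * t ^ k := fun i hi => by
    have : t ^ k = t ^ i * t ^ (k - i) := by
      rw [← pow_add, Nat.add_sub_cancel' (Nat.lt_succ_iff.1 (Finset.mem_range.1 hi))]
    rw [symVec, this]
    ring
  rw [Finset.sum_congr rfl h2, Finset.sum_add_distrib, Finset.sum_add_distrib, h1]
  simp
  ring

lemma pathA_mulVec_symVec {k : ℕ} (hk : 0 < k) (w : ℝ) {t : ℝ} (ht : t ≠ 0) (i : Fin (k + 1)) :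
    (pathA (k + 1) w *ᵥ fun j => symVec k t j) i = (t + t⁻¹) * symVec k t i +
      if i.val = 0 ∨ i.val = k then w * (1 + t ^ k) - (t⁻¹ + t ^ (k + 1)) else 0 := by
  rw [pathA_mulVec]
  obtain ⟨i, hi⟩ := i
  simp only [symVec]
  rcases Nat.eq_zero_or_pos i with rfl | hi0
  · obtain ⟨m, rfl⟩ := Nat.exists_eq_succ_of_ne_zero hk.ne'
    simp
    field_simp
    ring
  rcases (Nat.lt_succ_iff.1 hi).eq_or_lt with rfl | hik
  · obtain ⟨m, rfl⟩ := Nat.exists_eq_succ_of_ne_zero hk.ne'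
    simp
    field_simp
    ring
  · obtain ⟨m, rfl⟩ := Nat.exists_eq_succ_of_ne_zero hi0.ne'
    obtain ⟨l, rfl⟩ := Nat.exists_eq_add_of_lt hik
    have e1 : m.succ + l + 1 - m.succ = l + 1 := by omega
    have e2 : m.succ + l + 1 - (m.succ + 1) = l := by omega
    have e3 : m.succ + l + 1 - m = l + 2 := by omega
    have e4 : m.succ ≠ m.succ + l + 1 := by omega
    simp only [e1, e2, e4, hik, hi0, Nat.succ_ne_zero, or_self, if_true, if_false,
      Nat.succ_sub_one, e3]
    rw [Nat.succ_eq_add_one]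
    field_simp
    ring

lemma pathA_quadraticForm_symVec {k : ℕ} (hk : 0 < k) (w : ℝ) {t : ℝ} (ht : t ≠ 0) :
    ((fun i : Fin (k + 1) => symVec k t i) ⬝ᵥ pathA (k + 1) w *ᵥ fun i => symVec k t i) =
      (t + t⁻¹) * ∑ i ∈ range (k + 1), symVec k t i ^ 2 +
        2 * (1 + t ^ k) * (w * (1 + t ^ k) - (t⁻¹ + t ^ (k + 1))) := by
  set d := w * (1 + t ^ k) - (t⁻¹ + t ^ (k + 1))
  have : (pathA (k + 1) w *ᵥ fun j => symVec k t j) = fun i : Fin (k + 1) =>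
      (t + t⁻¹) * symVec k t i + if i.val = 0 ∨ i.val = k then d else 0 :=
    funext fun i => pathA_mulVec_symVec hk w ht i
  rw [this, sum_fin_mul_eq (k + 1) (symVec k t) fun i =>
    (t + t⁻¹) * symVec k t i + if i = 0 ∨ i = k then d else 0]
  simp only [mul_add, Finset.sum_add_distrib]
  have h1 : ∑ i ∈ range (k + 1), symVec k t i * (if i = 0 ∨ i = k then d else 0) =
      2 * (1 + t ^ k) * d := by
    obtain ⟨m, rfl⟩ := Nat.exists_eq_succ_of_ne_zero hk.ne'
    rw [Finset.sum_range_succ, Finset.sum_range_succ', Finset.sum_eq_zero]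
    · simp [symVec]
      ring
    · intro i hi
      have := Finset.mem_range.1 hi
      simp [this.ne]
  rw [h1, Finset.mul_sum]
  congr 1
  · exact Finset.sum_congr rfl fun i _ => by ring
  · ring

end Path

section SignFlip

lemma sum_mul_flip_eq_zero {k m : ℕ} (hkm : k + 1 = 2 * m) (f : ℕ → ℝ)
    (hf : ∀ i ≤ k, f (k - i) = f i) :
    ∑ i ∈ range (k + 1), f i * (if i < m then f i else -f i) = 0 := by
  have h := Finset.sum_range_reflect (fun i => f i * (if i < m then f i else -f i)) (k + 1)
  have h' : ∀ i ∈ range (k + 1), f (k + 1 - 1 - i) *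
      (if k + 1 - 1 - i < m then f (k + 1 - 1 - i) else -f (k + 1 - 1 - i)) =
      -(f i * (if i < m then f i else -f i)) := fun i hi => by
    have hik : i ≤ k := Nat.lt_succ_iff.1 (Finset.mem_range.1 hi)
    rw [Nat.add_sub_cancel, hf i hik]
    by_cases him : i < m
    · rw [if_neg (by omega), if_pos him]; ring
    · rw [if_pos (by omega), if_neg him]; ring
  rw [Finset.sum_congr rfl h', Finset.sum_neg_distrib] at h
  linarith

lemma sum_flip_mul_flip_succ {k m : ℕ} (hmk : m < k) (f : ℕ → ℝ) :
    ∑ i ∈ range k, (if i < m + 1 then f i else -f i) *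
        (if i + 1 < m + 1 then f (i + 1) else -f (i + 1)) =
      ∑ i ∈ range k, f i * f (i + 1) - 2 * (f m * f (m + 1)) := by
  have h : ∀ i ∈ range k, (if i < m + 1 then f i else -f i) *
        (if i + 1 < m + 1 then f (i + 1) else -f (i + 1)) =
      f i * f (i + 1) - if m = i then 2 * (f m * f (m + 1)) else 0 := fun i _ => by
    rcases lt_trichotomy i m with h | rfl | h
    · simp [h, h.ne', Nat.lt_succ_of_lt h]
    · simp; ring
    · simp [h.ne, Nat.not_le.2 h, h.le]
  rw [Finset.sum_congr rfl h, Finset.sum_sub_distrib]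
  simp [hmk]

end SignFlip

section Estimates

lemma exists_root_gt {k : ℕ} (hk : 0 < k) {w : ℝ} (hw : 1 < w) :
    ∃ t, w < t ∧ w * (1 + t ^ k) - (t⁻¹ + t ^ (k + 1)) = 0 := by
  obtain ⟨m, rfl⟩ := Nat.exists_eq_succ_of_ne_zero hk.ne'
  let g : ℝ → ℝ := fun t => 1 + t ^ (m + 3) - w * t - w * t ^ (m + 2)
  have hg : ContinuousOn g (Set.Icc w (w + 1)) := by fun_prop
  have h0 : g w < 0 := by
    have : g w = 1 - w ^ 2 := by simp only [g]; ring
    nlinarith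
  have h1 : 0 < g (w + 1) := by
    have : g (w + 1) = 1 + (w + 1) * ((w + 1) ^ m * (w + 1) - w) := by simp only [g]; ring
    have h : 1 ≤ (w + 1) ^ m := one_le_pow₀ (by linarith)
    have : 0 ≤ (w + 1) ^ m * (w + 1) - w := by nlinarith
    nlinarith [mul_nonneg (by linarith : (0 : ℝ) ≤ w + 1) this]
  obtain ⟨t, ht, hgt⟩ := intermediate_value_Ioo (by linarith) hg ⟨h0, h1⟩
  have htpos : t ≠ 0 := by linarith [ht.1]
  refine ⟨t, ht.1, ?_⟩
  have : w * (1 + t ^ (m + 1)) - (t⁻¹ + t ^ (m + 1 + 1)) = -g t * t⁻¹ := by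
    simp only [g]
    field_simp
    ring
  rw [Nat.succ_eq_add_one, this, hgt]
  simp

lemma mul_pow_le_geom_sum_mul (k : ℕ) {w : ℝ} (hw : 1 ≤ w) :
    (k + 1) * (w ^ k * (w + 1)) ≤ (∑ i ∈ range (k + 1), w ^ i) * (w + w ^ k) := by
  have hrefl : ∑ i ∈ range (k + 1), w ^ (k - i) = ∑ i ∈ range (k + 1), w ^ i := by
    simpa using Finset.sum_range_reflect (fun i => w ^ i) (k + 1)
  rw [mul_add (∑ i ∈ range (k + 1), w ^ i)]
  nth_rw 2 [← hrefl]
  rw [Finset.sum_mul, Finset.sum_mul, ← Finset.sum_add_distrib]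
  have hterm : ∀ i ∈ range (k + 1), w ^ k * (w + 1) ≤ w ^ i * w + w ^ (k - i) * w ^ k :=
    fun i hi => by
      obtain ⟨d, rfl⟩ := Nat.exists_eq_add_of_le (Nat.lt_succ_iff.1 (Finset.mem_range.1 hi))
      have hd : 0 ≤ (w ^ d - w) * (w ^ d - 1) := by
        cases d with
        | zero => simp
        | succ d =>
          exact mul_nonneg (sub_nonneg.2 (le_self_pow₀ hw (by omega)))
            (sub_nonneg.2 (one_le_pow₀ hw))
      have := mul_nonneg (pow_nonneg (zero_le_one.trans hw) i) hd
      rw [Nat.add_sub_cancel_left, pow_add]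
      linear_combination this
  simpa using Finset.card_nsmul_le_sum _ _ _ hterm

lemma gap_lower_estimate (k : ℕ) {w : ℝ} (hw : 1 < w) :
    (w - 1) ^ 2 * (w + 1) / (w * (w ^ (k + 1) - 1)) ≤
      2 * (1 + w ^ k) * (w - w⁻¹) /
        (2 * (∑ i ∈ range (k + 1), (w ^ 2) ^ i + (k + 1) * w ^ k)) := by
  have hw0 : 0 < w := by linarith
  have hE : 0 < w ^ (k + 1) - 1 := sub_pos.2 (one_lt_pow₀ hw (by omega))
  have hP := mul_geom_sum w (k + 1)
  have hS : (w + 1) * ∑ i ∈ range (k + 1), (w ^ 2) ^ i =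
      (∑ i ∈ range (k + 1), w ^ i) * (w ^ (k + 1) + 1) := by
    have h2 := mul_geom_sum (w ^ 2) (k + 1)
    refine mul_left_cancel₀ (sub_pos.2 hw).ne' ?_
    linear_combination h2 - hP * (w ^ (k + 1) + 1)
  have hineq := mul_pow_le_geom_sum_mul k hw.le
  have hSpos : 0 < ∑ i ∈ range (k + 1), (w ^ 2) ^ i :=
    Finset.sum_pos (fun i _ => by positivity) ⟨0, by simp⟩
  set P := ∑ i ∈ range (k + 1), w ^ i
  set S := ∑ i ∈ range (k + 1), (w ^ 2) ^ i
  have key : S + (k + 1) * w ^ k ≤ (1 + w ^ k) * P := by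
    have : (w + 1) * (S + (k + 1) * w ^ k) ≤ (w + 1) * ((1 + w ^ k) * P) := by
      rw [mul_add, hS]
      linear_combination hineq
    exact le_of_mul_le_mul_left this (by linarith)
  have hw' : w - w⁻¹ = (w - 1) * (w + 1) / w := by field_simp; ring
  rw [hw', ← hP, div_le_div_iff₀ (by rw [hP]; positivity) (by positivity)]
  have h3 : 0 ≤ 2 * (w - 1) ^ 2 * (w + 1) :=
    mul_nonneg (by positivity) (by linarith)
  have := mul_le_mul_of_nonneg_left key h3
  have e : 2 * (1 + w ^ k) * ((w - 1) * (w + 1) / w) * (w * ((w - 1) * P)) =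
      2 * (w - 1) ^ 2 * (w + 1) * ((1 + w ^ k) * P) := by
    field_simp
  rw [e]
  linear_combination this

lemma gap_upper_estimate {m : ℕ} {w t : ℝ} (hw : 1 < w) (ht : w ≤ t) :
    4 * (t ^ m + t ^ (m + 1)) ^ 2 /
        (2 * (∑ i ∈ range (2 * m + 1 + 1), (t ^ 2) ^ i + ((2 * m + 1 : ℕ) + 1) * t ^ (2 * m + 1))) ≤
      2 * (w - 1) * (w + 1) ^ 3 / (w ^ 2 * (w ^ (2 * m + 1 + 1) - 1)) := by
  have hw0 : 0 < w := by linarith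
  have ht1 : 1 < t := by linarith
  have ht0 : 0 < t := by linarith
  have hQ : ∀ s : ℝ, s ^ (2 * m + 1 + 1) - 1 = (s ^ 2 - 1) * ∑ i ∈ range (m + 1), (s ^ 2) ^ i :=
    fun s => by rw [mul_geom_sum]; ring
  have hQpos : ∀ s : ℝ, 0 < s → 0 < ∑ i ∈ range (m + 1), (s ^ 2) ^ i := fun s hs =>
    Finset.sum_pos (fun i _ => by positivity) ⟨0, by simp⟩
  have hmono : ∑ i ∈ range (m + 1), (w ^ 2) ^ i ≤ ∑ i ∈ range (m + 1), (t ^ 2) ^ i :=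
    Finset.sum_le_sum fun i _ => by gcongr
  have hQw := hQpos w hw0
  have hQt := hQpos t ht0
  have hS : t ^ (2 * m + 2) * ∑ i ∈ range (m + 1), (t ^ 2) ^ i ≤
      ∑ i ∈ range (2 * m + 1 + 1), (t ^ 2) ^ i + ((2 * m + 1 : ℕ) + 1) * t ^ (2 * m + 1) := by
    have hsum : ∑ i ∈ range (2 * m + 1 + 1), (t ^ 2) ^ i =
        (∑ i ∈ range (m + 1), (t ^ 2) ^ i) * (t ^ (2 * m + 1 + 1) + 1) := by
      have h2 := mul_geom_sum (t ^ 2) (2 * m + 1 + 1)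
      refine mul_left_cancel₀ (by nlinarith : t ^ 2 - 1 ≠ 0) ?_
      linear_combination h2 + hQ t * (t ^ (2 * m + 1 + 1) + 1)
    have : 0 ≤ ((2 * m + 1 : ℕ) + 1) * t ^ (2 * m + 1) := by positivity
    rw [hsum]
    linear_combination this + hQt.le
  calc _ ≤ 4 * (t ^ m + t ^ (m + 1)) ^ 2 /
        (2 * (t ^ (2 * m + 2) * ∑ i ∈ range (m + 1), (t ^ 2) ^ i)) := by gcongr
    _ = 2 * (1 + t⁻¹) ^ 2 / ∑ i ∈ range (m + 1), (t ^ 2) ^ i := by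
      field_simp
      ring
    _ ≤ 2 * (1 + w⁻¹) ^ 2 / ∑ i ∈ range (m + 1), (w ^ 2) ^ i := by gcongr
    _ = _ := by
      have : w ^ 2 - 1 ≠ 0 := by nlinarith
      rw [hQ w]
      field_simp
      ring

end Estimates

section Gap

variable {k : ℕ} {w : ℝ} {μ : Fin (k + 1) → ℝ}

lemma IsEigList.apply_le (hk : 0 < k) (hw : 0 < w) (hμ : IsEigList (k + 1) w μ) {j : Fin (k + 1)}
    (hj : j ≠ 0) : μ j ≤ w + w⁻¹ := by
  obtain ⟨u, hu, horth, -⟩ := (pathA_isHermitian _ w).exists_eigenbasis_of_charpoly_eq hμ.2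
  exact eigenvalue_le_of_hyperplane hu horth 0 (pathA_quadraticForm_le hk hw) hj.symm
    (hμ.1 (Fin.zero_le j))

lemma sum_symVec_sq_pos (k : ℕ) {t : ℝ} (ht : 0 < t) :
    0 < ∑ i ∈ range (k + 1), symVec k t i ^ 2 :=
  Finset.sum_pos (fun i _ => by unfold symVec; positivity) ⟨0, by simp⟩

lemma IsEigList.le_gap (hk : 0 < k) (hw : 1 < w) (hμ : IsEigList (k + 1) w μ) {j : Fin (k + 1)}
    (hj : j ≠ 0) :
    (w - 1) ^ 2 * (w + 1) / (w * (w ^ (k + 1) - 1)) ≤ μ 0 - μ j := by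
  have hw0 : 0 < w := by linarith
  have hA := pathA_isHermitian (k + 1) w
  obtain ⟨u, hu, -, hsum⟩ := hA.exists_eigenbasis_of_charpoly_eq hμ.2
  have hN := sum_symVec_sq_pos k hw0
  have h := dotProduct_mulVec_le hA hu hsum (c := μ 0)
    (x := fun i : Fin (k + 1) => symVec k w i) fun i hi => absurd hi (hμ.1 (Fin.zero_le i)).not_gt
  rw [pathA_quadraticForm_symVec hk w hw0.ne', sum_fin_mul_eq] at h
  simp only [← sq] at h
  have hj' := hμ.apply_le hk hw0 hj
  refine (gap_lower_estimate k hw).trans ?_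
  rw [← sum_symVec_sq, div_le_iff₀ hN]
  have := mul_le_mul_of_nonneg_right hj' hN.le
  linear_combination h + this

lemma IsEigList.gap_le {m : ℕ} {μ : Fin (2 * m + 1 + 1) → ℝ} (hw : 1 < w)
    (hμ : IsEigList (2 * m + 1 + 1) w μ) :
    μ 0 - μ 1 ≤ 2 * (w - 1) * (w + 1) ^ 3 / (w ^ 2 * (w ^ (2 * m + 1 + 1) - 1)) := by
  have hk : 0 < 2 * m + 1 := by omega
  have hw0 : 0 < w := by linarith
  have hA := pathA_isHermitian (2 * m + 1 + 1) w
  obtain ⟨u, hu, -, hsum⟩ := hA.exists_eigenbasis_of_charpoly_eq hμ.2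
  obtain ⟨t, hwt, ht⟩ := exists_root_gt hk hw
  have ht0 : 0 < t := hw0.trans hwt
  have hN := sum_symVec_sq_pos (2 * m + 1) ht0
  have hρ : w + w⁻¹ < t + t⁻¹ := by
    have h1 : 1 < t * w := by nlinarith
    have : t + t⁻¹ - (w + w⁻¹) = (t - w) * (t * w - 1) / (t * w) := by field_simp; ring
    have := div_pos (mul_pos (sub_pos.2 hwt) (sub_pos.2 h1)) (mul_pos ht0 hw0)
    linarith
  obtain ⟨h0, hz⟩ := eigenvalue_eq_of_forall_lt hA hu hsum (k := 0) (ρ := t + t⁻¹)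
    (y := fun i => symVec (2 * m + 1) t i) (fun i hi => (hμ.apply_le hk hw0 hi).trans_lt hρ)
    (by ext i; rw [pathA_mulVec_symVec hk w ht0.ne', ht]; simp)
    (by rw [sum_fin_mul_eq]; simpa only [← sq] using hN)
  set f := symVec (2 * m + 1) t with hf
  let g : ℕ → ℝ := fun i => if i < m + 1 then f i else -f i
  have hfg : ((fun i : Fin (2 * m + 1 + 1) => f i) ⬝ᵥ fun i => g i) = 0 := by
    rw [sum_fin_mul_eq]
    exact sum_mul_flip_eq_zero (by ring) f fun i hi => symVec_reflect t hi
  have h := dotProduct_mulVec_le hA hu hsum (c := μ 1) (x := fun i => g i) fun i hi => by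
    rcases eq_or_ne i 0 with rfl | hi0
    · exact hz _ hfg
    · exact absurd hi (hμ.1 (Fin.one_le_of_ne_zero hi0)).not_gt
  have hgsq : ∀ i, g i ^ 2 = f i ^ 2 := fun i => by
    simp only [g]; split_ifs <;> ring
  have hff := pathA_quadraticForm_symVec hk w ht0.ne'
  rw [ht, mul_zero, add_zero, pathA_quadraticForm hk, ← hf] at hff
  rw [pathA_quadraticForm hk, sum_fin_mul_eq, sum_flip_mul_flip_succ (by omega) f, hgsq,
    hgsq] at h
  simp only [← sq, hgsq] at h
  have hm : f m * f (m + 1) = (t ^ m + t ^ (m + 1)) ^ 2 := by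
    have e1 : 2 * m + 1 - m = m + 1 := by omega
    have e2 : 2 * m + 1 - (m + 1) = m := by omega
    rw [hf, symVec, symVec, e1, e2]
    ring
  refine le_trans ?_ (gap_upper_estimate hw hwt.le)
  rw [← sum_symVec_sq, ← hf, le_div_iff₀ hN, ← hm, h0]
  linear_combination h - hff

end Gap

/-- For even `n ≥ 4` and `w > 1`:
`(w−1)²(w+1)/(w(wⁿ−1)) ≤ λ₁ − λ₂ ≤ 2(w−1)(w+1)³/(w²(wⁿ−1))`. -/
theorem gap_bounds_even (n : ℕ) (hn : 4 ≤ n) (hne : Even n) (w : ℝ) (hw : 1 < w)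
    (μ : Fin n → ℝ) (hμ : IsEigList n w μ) :
    (w - 1) ^ 2 * (w + 1) / (w * (w ^ n - 1))
        ≤ μ ⟨0, by omega⟩ - μ ⟨1, by omega⟩ ∧
    μ ⟨0, by omega⟩ - μ ⟨1, by omega⟩
        ≤ 2 * (w - 1) * (w + 1) ^ 3 / (w ^ 2 * (w ^ n - 1)) := by
  obtain ⟨m, rfl⟩ : ∃ m, n = 2 * m + 1 + 1 := by
    obtain ⟨r, rfl⟩ := hne
    exact ⟨r - 1, by omega⟩
  exact ⟨hμ.le_gap (by omega) hw (j := 1) (by simp), hμ.gap_le hw⟩
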